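/- arXiv:1804.05116 — 7 statements merged into one kernel-verified Lean document; each statement's English description precedes it below -/
import Mathlib

section
/- The ideal correlation p* is a genuine correlation: for every x ∈ {0,1,2,3} and y ∈ {0,1,2,3,4}, one has p*(a,b|x,y) ≥ 0 for all a,b ∈ {0,1,2}, and Σ_{a∈{0,1,2}} Σ_{b∈{0,1,2}} p*(a,b|x,y) = 1. -/
open Matrix Kronecker

noncomputable section

namespace Sep

/-- Pauli `σz`. -/
def sz : Matrix (Fin 2) (Fin 2) ℝ := !![1, 0; 0, -1]

/-- Pauli `σx`. -/
def sx : Matrix (Fin 2) (Fin 2) ℝ := !![0, 1; 1, 0]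

/-- `μ = arctan (sin 2θ)` where `θ = arctan α`. -/
def mu (α : ℝ) : ℝ := Real.arctan (Real.sin (2 * Real.arctan α))

/-- The tilted Pauli `σαz`. -/
def saz (α : ℝ) : Matrix (Fin 2) (Fin 2) ℝ :=
  Real.cos (mu α) • sz + Real.sin (mu α) • sx

/-- The tilted Pauli `σαx`. -/
def sax (α : ℝ) : Matrix (Fin 2) (Fin 2) ℝ :=
  Real.cos (mu α) • sz - Real.sin (mu α) • sx

/-- Orthogonal projection onto the `+1`-eigenspace of a symmetric involution `O`
(with eigenvalues `+1` and `-1`): `O⁺ = (I + O)/2`. -/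
def pl (O : Matrix (Fin 2) (Fin 2) ℝ) : Matrix (Fin 2) (Fin 2) ℝ := (2 : ℝ)⁻¹ • (1 + O)

/-- Orthogonal projection onto the `-1`-eigenspace: `O⁻ = (I - O)/2`. -/
def mn (O : Matrix (Fin 2) (Fin 2) ℝ) : Matrix (Fin 2) (Fin 2) ℝ := (2 : ℝ)⁻¹ • (1 - O)

/-- Embed a `2×2` matrix `O` as an `ℕ×ℕ` matrix supported on rows/columns `f 0, f 1`,
with entry `O r s` at position `(f r, f s)`. -/
def embed (f : Fin 2 → ℕ) (O : Matrix (Fin 2) (Fin 2) ℝ) : Matrix ℕ ℕ ℝ :=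
  fun i j => ∑ r : Fin 2, ∑ s : Fin 2, if i = f r ∧ j = f s then O r s else 0

/-- `ev_m(O)`: supported on `{2m, 2m+1}`. -/
def evm (m : ℕ) (O : Matrix (Fin 2) (Fin 2) ℝ) : Matrix ℕ ℕ ℝ :=
  embed (fun r => 2 * m + (r : ℕ)) O

/-- `od_m(O)`: supported on `{2m+1, 2m+2}`. -/
def odm (m : ℕ) (O : Matrix (Fin 2) (Fin 2) ℝ) : Matrix ℕ ℕ ℝ :=
  embed (fun r => 2 * m + 1 + (r : ℕ)) O

/-- Entrywise sum `Σ_m F m` of a family of `ℕ×ℕ` matrices. -/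
def sumB (F : ℕ → Matrix ℕ ℕ ℝ) : Matrix ℕ ℕ ℝ := fun i j => ∑' m, F m i j

/-- The `ℕ×ℕ` matrix with a single `1` entry at `(0,0)`. -/
def E00 : Matrix ℕ ℕ ℝ := fun i j => if i = 0 ∧ j = 0 then 1 else 0

/-- Alice's ideal operators `A_x^a`. -/
def Aop : Fin 4 → Fin 3 → Matrix ℕ ℕ ℝ :=
  ![![sumB (fun m => evm m (pl sz)), sumB (fun m => evm m (mn sz)), 0],
    ![sumB (fun m => evm m (pl sx)), sumB (fun m => evm m (mn sx)), 0],
    ![sumB (fun m => odm m (mn sz)), sumB (fun m => odm m (pl sz)), E00],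
    ![sumB (fun m => odm m (mn sx)), sumB (fun m => odm m (pl sx)), E00]]

/-- Bob's ideal operators `B_y^b`. -/
def Bop (α : ℝ) : Fin 5 → Fin 3 → Matrix ℕ ℕ ℝ :=
  ![![sumB (fun m => evm m (pl (saz α))), sumB (fun m => evm m (mn (saz α))), 0],
    ![sumB (fun m => evm m (pl (sax α))), sumB (fun m => evm m (mn (sax α))), 0],
    ![sumB (fun m => odm m (mn (saz α))), sumB (fun m => odm m (pl (saz α))), E00],
    ![sumB (fun m => odm m (mn (sax α))), sumB (fun m => odm m (pl (sax α))), E00],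
    ![Aop 0 0, Aop 0 1, Aop 0 2]]

/-- The ideal correlation `p*(a,b|x,y) = (1-α²) Σ_{i,k} α^{i+k} A_x^a(i,k) B_y^b(i,k)`. -/
def pstar (α : ℝ) (x : Fin 4) (y : Fin 5) (a b : Fin 3) : ℝ :=
  (1 - α ^ 2) * ∑' ik : ℕ × ℕ, α ^ (ik.1 + ik.2) * Aop x a ik.1 ik.2 * Bop α y b ik.1 ik.2

/-- A finite-dimensional strategy on question sets `Fin 4`, `Fin 5` and
answer sets `Fin 3`, `Fin 3`. -/
structure Strategy (dA dB : ℕ) where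
  ψ : Fin dA × Fin dB → ℂ
  P : Fin 4 → Fin 3 → Matrix (Fin dA) (Fin dA) ℂ
  Q : Fin 5 → Fin 3 → Matrix (Fin dB) (Fin dB) ℂ
  unit : ∑ p : Fin dA × Fin dB, Complex.normSq (ψ p) = 1
  P_sa : ∀ x a, (P x a)ᴴ = P x a
  P_proj : ∀ x a, P x a * P x a = P x a
  P_complete : ∀ x, ∑ a, P x a = 1
  Q_sa : ∀ y b, (Q y b)ᴴ = Q y b
  Q_proj : ∀ y b, Q y b * Q y b = Q y b
  Q_complete : ∀ y, ∑ b, Q y b = 1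

/-- Action of `P ⊗ I` on a bipartite vector. -/
def actA {dA dB : ℕ} (P : Matrix (Fin dA) (Fin dA) ℂ) (ψ : Fin dA × Fin dB → ℂ) :
    Fin dA × Fin dB → ℂ := fun p => ∑ k, P p.1 k * ψ (k, p.2)

/-- Action of `I ⊗ Q` on a bipartite vector. -/
def actB {dA dB : ℕ} (Q : Matrix (Fin dB) (Fin dB) ℂ) (ψ : Fin dA × Fin dB → ℂ) :
    Fin dA × Fin dB → ℂ := fun p => ∑ l, Q p.2 l * ψ (p.1, l)

/-- The correlation induced by a strategy: `⟨ψ, (P_x^a ⊗ Q_y^b) ψ⟩`. -/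
def induced {dA dB : ℕ} (S : Strategy dA dB) (x : Fin 4) (y : Fin 5) (a b : Fin 3) : ℂ :=
  ∑ p : Fin dA × Fin dB, (starRingEnd ℂ) (S.ψ p) * actA (S.P x a) (actB (S.Q y b) S.ψ) p

open Filter

/-- A family of positive semidefinite matrices on `ι` that sums to the identity. -/
structure IsPOVM {κ ι : Type*} [Fintype κ] [DecidableEq ι] (F : κ → Matrix ι ι ℝ) : Prop where
  posSemidef : ∀ a, (F a).PosSemidef
  sum_eq_one : ∑ a, F a = 1

lemma two_mul_abs_le_of_posSemidef {ι : Type*} {A : Matrix ι ι ℝ} (hA : A.PosSemidef) (i j : ι) :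
    2 * |A i j| ≤ A i i + A j j := by
  have hs : A j i = A i j := by simpa using hA.isHermitian.apply i j
  have h := hA.submatrix ![i, j]
  have h₁ := h.dotProduct_mulVec_nonneg ![1, 1]
  have h₂ := h.dotProduct_mulVec_nonneg ![1, -1]
  simp [Matrix.mulVec, dotProduct, Fin.sum_univ_two, hs] at h₁ h₂
  rcases abs_cases (A i j) with h | h <;> linarith

section POVM

variable {κ κ' ι : Type*} [Fintype κ] [Fintype κ'] [DecidableEq ι]

lemma IsPOVM.diag_le_one {F : κ → Matrix ι ι ℝ} (hF : IsPOVM F) (a : κ) (i : ι) :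
    F a i i ≤ 1 := by
  have h : ∑ a, F a i i = 1 := by
    rw [← Matrix.sum_apply, hF.sum_eq_one, Matrix.one_apply_eq]
  rw [← h]
  exact Finset.single_le_sum (f := fun a => F a i i) (fun b _ => (hF.posSemidef b).diag_nonneg)
    (Finset.mem_univ a)

lemma IsPOVM.abs_apply_le_one {F : κ → Matrix ι ι ℝ} (hF : IsPOVM F) (a : κ) (i j : ι) :
    |F a i j| ≤ 1 := by
  linarith [two_mul_abs_le_of_posSemidef (hF.posSemidef a) i j, hF.diag_le_one a i,
    hF.diag_le_one a j]

lemma summable_pow_add {α : ℝ} (hα0 : 0 ≤ α) (hα1 : α < 1) :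
    Summable fun ik : ℕ × ℕ => α ^ (ik.1 + ik.2) := by
  simp only [pow_add]
  exact (summable_geometric_of_lt_one hα0 hα1).mul_of_nonneg
    (summable_geometric_of_lt_one hα0 hα1) (fun _ => by positivity) (fun _ => by positivity)

lemma IsPOVM.summable_pow_mul {α : ℝ} (hα0 : 0 ≤ α) (hα1 : α < 1)
    {F : κ → Matrix ℕ ℕ ℝ} {G : κ' → Matrix ℕ ℕ ℝ} (hF : IsPOVM F) (hG : IsPOVM G)
    (a : κ) (b : κ') :
    Summable fun ik : ℕ × ℕ => α ^ (ik.1 + ik.2) * F a ik.1 ik.2 * G b ik.1 ik.2 := by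
  refine (summable_pow_add hα0 hα1).of_norm_bounded fun ik => ?_
  rw [Real.norm_eq_abs, abs_mul, abs_mul, abs_of_nonneg (by positivity), mul_assoc]
  exact mul_le_of_le_one_right (by positivity)
    (mul_le_one₀ (hF.abs_apply_le_one a _ _) (abs_nonneg _) (hG.abs_apply_le_one b _ _))

lemma tsum_mul_mul_nonneg_of_posSemidef {M : Matrix ℕ ℕ ℝ} (hM : M.PosSemidef) (v : ℕ → ℝ) :
    0 ≤ ∑' ik : ℕ × ℕ, v ik.1 * M ik.1 ik.2 * v ik.2 := by
  by_cases hs : Summable fun ik : ℕ × ℕ => v ik.1 * M ik.1 ik.2 * v ik.2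
  · have ht : Tendsto (fun n : ℕ => Finset.range n ×ˢ Finset.range n) atTop atTop :=
      by
      refine tendsto_atTop_finset_of_monotone
        (fun m n h => Finset.product_subset_product (Finset.range_mono h) (Finset.range_mono h))
        fun ik => ⟨max ik.1 ik.2 + 1, ?_⟩
      simp only [Finset.mem_product, Finset.mem_range]
      omega
    refine ge_of_tendsto' (hs.hasSum.comp ht) fun n => ?_
    have h := (hM.submatrix (fun i : Fin n => (i : ℕ))).dotProduct_mulVec_nonneg fun i => v i
    simpa [Matrix.mulVec, dotProduct, Finset.mul_sum, Finset.sum_product, Finset.sum_range,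
      mul_assoc] using h
  · rw [tsum_eq_zero_of_not_summable hs]

lemma tsum_pow_mul_mul_nonneg {A B : Matrix ℕ ℕ ℝ} (hA : A.PosSemidef) (hB : B.PosSemidef)
    (α : ℝ) : 0 ≤ ∑' ik : ℕ × ℕ, α ^ (ik.1 + ik.2) * A ik.1 ik.2 * B ik.1 ik.2 := by
  convert tsum_mul_mul_nonneg_of_posSemidef (hA.hadamard hB) (fun i => α ^ i) using 3 with ik
  rw [Matrix.hadamard_apply, pow_add]
  ring

lemma tsum_pow_mul_one_apply {α : ℝ} (hα0 : 0 ≤ α) (hα1 : α < 1) :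
    ∑' ik : ℕ × ℕ, α ^ (ik.1 + ik.2) * (1 : Matrix ℕ ℕ ℝ) ik.1 ik.2 = (1 - α ^ 2)⁻¹ := by
  have hs : Summable fun ik : ℕ × ℕ => α ^ (ik.1 + ik.2) * (1 : Matrix ℕ ℕ ℝ) ik.1 ik.2 := by
    refine (summable_pow_add hα0 hα1).of_nonneg_of_le (fun ik => ?_) fun ik => ?_ <;>
      rw [Matrix.one_apply] <;> split_ifs <;> simp <;> positivity
  rw [hs.tsum_prod, ← tsum_geometric_of_lt_one (sq_nonneg α) (by nlinarith)]
  refine tsum_congr fun i => ?_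
  rw [tsum_eq_single i fun k hk => by simp [Matrix.one_apply_ne' hk]]
  simp only [Matrix.one_apply_eq, mul_one]
  ring

lemma IsPOVM.sum_tsum_pow_mul {α : ℝ} (hα0 : 0 ≤ α) (hα1 : α < 1)
    {F : κ → Matrix ℕ ℕ ℝ} {G : κ' → Matrix ℕ ℕ ℝ} (hF : IsPOVM F) (hG : IsPOVM G) :
    ∑ a, ∑ b, ∑' ik : ℕ × ℕ, α ^ (ik.1 + ik.2) * F a ik.1 ik.2 * G b ik.1 ik.2 =
      (1 - α ^ 2)⁻¹ := by
  have hs := hF.summable_pow_mul hα0 hα1 hG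
  rw [← tsum_pow_mul_one_apply hα0 hα1]
  simp_rw [← Summable.tsum_finsetSum fun b _ => hs _ b]
  rw [← Summable.tsum_finsetSum fun a _ => summable_sum fun b _ => hs a b]
  refine tsum_congr fun ik => ?_
  have h₁ : ∑ a, F a ik.1 ik.2 = (1 : Matrix ℕ ℕ ℝ) ik.1 ik.2 := by
    rw [← hF.sum_eq_one, Matrix.sum_apply]
  have h₂ : ∑ b, G b ik.1 ik.2 = (1 : Matrix ℕ ℕ ℝ) ik.1 ik.2 := by
    rw [← hG.sum_eq_one, Matrix.sum_apply]
  simp_rw [← Finset.mul_sum, h₂, ← Finset.sum_mul, ← Finset.mul_sum, h₁, mul_assoc,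
    Matrix.one_apply]
  split_ifs <;> simp

end POVM

section Blocks

lemma sumB_embed_eq (c : ℕ) (O : Matrix (Fin 2) (Fin 2) ℝ) :
    sumB (fun m => embed (fun r => 2 * m + c + (r : ℕ)) O) =
      O.submatrix (fun i => Fin.ofNat 2 (i + c)) (fun i => Fin.ofNat 2 (i + c)) ⊙
        (Matrix.diagonal fun m => if c ≤ m then (1 : ℝ) else 0).submatrix
          (fun i => (i + c) / 2) (fun i => (i + c) / 2) := by
  have key : ∀ i m (r : Fin 2), i = 2 * m + c + (r : ℕ) ↔
      (i + c) / 2 = m + c ∧ Fin.ofNat 2 (i + c) = r := by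
    intro i m r
    rw [Fin.ext_iff, Fin.val_ofNat]
    omega
  have hentry : ∀ m i j, embed (fun r => 2 * m + c + (r : ℕ)) O i j =
      if (i + c) / 2 = m + c ∧ (j + c) / 2 = m + c then
        O (Fin.ofNat 2 (i + c)) (Fin.ofNat 2 (j + c)) else 0 := by
    intro m i j
    simp only [embed, key]
    by_cases h₁ : (i + c) / 2 = m + c <;> by_cases h₂ : (j + c) / 2 = m + c <;>
      simp [h₁, h₂, ite_and]
  ext i j
  simp only [sumB, hentry, Matrix.hadamard_apply, Matrix.submatrix_apply, Matrix.diagonal_apply]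
  rw [tsum_eq_single ((i + c) / 2 - c) fun m hm => if_neg (by omega)]
  split_ifs <;> first | omega | simp

lemma posSemidef_sumB_embed (c : ℕ) {O : Matrix (Fin 2) (Fin 2) ℝ} (hO : O.PosSemidef) :
    (sumB fun m => embed (fun r => 2 * m + c + (r : ℕ)) O).PosSemidef := by
  rw [sumB_embed_eq]
  refine (hO.submatrix _).hadamard (Matrix.PosSemidef.submatrix (.diagonal fun m => ?_) _)
  dsimp only [Pi.zero_apply]
  split_ifs <;> simp

lemma sumB_embed_add_of_add_eq_one (c : ℕ) {P Q : Matrix (Fin 2) (Fin 2) ℝ} (h : P + Q = 1) :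
    (sumB fun m => embed (fun r => 2 * m + c + (r : ℕ)) P) +
      (sumB fun m => embed (fun r => 2 * m + c + (r : ℕ)) Q) =
      Matrix.diagonal fun i => if c ≤ i then 1 else 0 := by
  have hPQ : ∀ r s, P r s + Q r s = (1 : Matrix (Fin 2) (Fin 2) ℝ) r s := fun r s => by
    rw [← h, Matrix.add_apply]
  rw [sumB_embed_eq, sumB_embed_eq, ← Matrix.add_hadamard]
  ext i j
  simp only [Matrix.hadamard_apply, Matrix.add_apply, Matrix.submatrix_apply, hPQ,
    Matrix.diagonal_apply, Matrix.one_apply, Fin.ext_iff, Fin.val_ofNat]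
  split_ifs <;> first | omega | simp

lemma E00_eq_diagonal : E00 = Matrix.diagonal fun i => if i = 0 then 1 else 0 := by
  ext i j
  simp only [E00, Matrix.diagonal_apply]
  split_ifs <;> first | omega | rfl

variable {P Q : Matrix (Fin 2) (Fin 2) ℝ}

lemma isPOVM_sumB_evm (hP : P.PosSemidef) (hQ : Q.PosSemidef) (h : P + Q = 1) :
    IsPOVM ![sumB fun m => evm m P, sumB fun m => evm m Q, 0] where
  posSemidef := Fin.forall_fin_succ.2 ⟨posSemidef_sumB_embed 0 hP,
    Fin.forall_fin_two.2 ⟨posSemidef_sumB_embed 0 hQ, .zero⟩⟩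
  sum_eq_one := by
    rw [Fin.sum_univ_three]
    have := sumB_embed_add_of_add_eq_one 0 h
    simpa [evm] using this

lemma isPOVM_sumB_odm (hP : P.PosSemidef) (hQ : Q.PosSemidef) (h : P + Q = 1) :
    IsPOVM ![sumB fun m => odm m P, sumB fun m => odm m Q, E00] where
  posSemidef := Fin.forall_fin_succ.2 ⟨posSemidef_sumB_embed 1 hP,
    Fin.forall_fin_two.2 ⟨posSemidef_sumB_embed 1 hQ, by
      simp only [Matrix.cons_val_succ, Matrix.cons_val_one, Matrix.cons_val_fin_one]
      rw [E00_eq_diagonal]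
      refine .diagonal fun i => ?_
      dsimp only [Pi.zero_apply]
      split_ifs <;> simp⟩⟩
  sum_eq_one := by
    rw [Fin.sum_univ_three]
    have := sumB_embed_add_of_add_eq_one 1 h
    simp only [Matrix.cons_val, odm, this, E00_eq_diagonal, Matrix.diagonal_add]
    rw [← Matrix.diagonal_one]
    congr 1
    ext i
    split_ifs <;> first | omega | simp

end Blocks

section Projections

variable {O : Matrix (Fin 2) (Fin 2) ℝ}

lemma posSemidef_pl (hs : O.IsHermitian) (h : O * O = 1) : (pl O).PosSemidef := by
  have hpl : pl O = (pl O)ᴴ * pl O := by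
    simp only [pl, Matrix.conjTranspose_smul, Matrix.conjTranspose_add, hs.eq,
      Matrix.conjTranspose_one, Matrix.smul_mul, Matrix.mul_smul, add_mul, mul_add, h, one_mul,
      mul_one, star_trivial]
    module
  rw [hpl]
  exact Matrix.posSemidef_conjTranspose_mul_self _

lemma posSemidef_mn (hs : O.IsHermitian) (h : O * O = 1) : (mn O).PosSemidef := by
  have := posSemidef_pl hs.neg (by rwa [neg_mul_neg])
  rwa [pl, ← sub_eq_add_neg] at this

lemma pl_add_mn (O : Matrix (Fin 2) (Fin 2) ℝ) : pl O + mn O = 1 := by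
  simp only [pl, mn]
  module

lemma isPOVM_evm_pl_mn (hs : O.IsHermitian) (h : O * O = 1) :
    IsPOVM ![sumB fun m => evm m (pl O), sumB fun m => evm m (mn O), 0] :=
  isPOVM_sumB_evm (posSemidef_pl hs h) (posSemidef_mn hs h) (pl_add_mn O)

lemma isPOVM_odm_mn_pl (hs : O.IsHermitian) (h : O * O = 1) :
    IsPOVM ![sumB fun m => odm m (mn O), sumB fun m => odm m (pl O), E00] :=
  isPOVM_sumB_odm (posSemidef_mn hs h) (posSemidef_pl hs h) (by rw [add_comm, pl_add_mn])

lemma isHermitian_sz : sz.IsHermitian := by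
  ext i j; fin_cases i <;> fin_cases j <;> simp [sz]

lemma isHermitian_sx : sx.IsHermitian := by
  ext i j; fin_cases i <;> fin_cases j <;> simp [sx]

lemma sz_mul_sz : sz * sz = 1 := by
  simp [sz, Matrix.one_fin_two]

lemma sx_mul_sx : sx * sx = 1 := by
  simp [sx, Matrix.one_fin_two]

lemma isHermitian_saz (α : ℝ) : (saz α).IsHermitian :=
  (isHermitian_sz.smul (.all _)).add (isHermitian_sx.smul (.all _))

lemma isHermitian_sax (α : ℝ) : (sax α).IsHermitian :=
  (isHermitian_sz.smul (.all _)).sub (isHermitian_sx.smul (.all _))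

lemma saz_mul_saz (α : ℝ) : saz α * saz α = 1 := by
  have h := Real.cos_sq_add_sin_sq (mu α)
  ext i j
  fin_cases i <;> fin_cases j <;> simp [saz, sz, sx] <;> linarith

lemma sax_mul_sax (α : ℝ) : sax α * sax α = 1 := by
  have h := Real.cos_sq_add_sin_sq (mu α)
  ext i j
  fin_cases i <;> fin_cases j <;> simp [sax, sz, sx] <;> linarith

end Projections

lemma isPOVM_Aop (x : Fin 4) : IsPOVM (Aop x) := by
  fin_cases x
  exacts [isPOVM_evm_pl_mn isHermitian_sz sz_mul_sz, isPOVM_evm_pl_mn isHermitian_sx sx_mul_sx,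
    isPOVM_odm_mn_pl isHermitian_sz sz_mul_sz, isPOVM_odm_mn_pl isHermitian_sx sx_mul_sx]

lemma isPOVM_Bop (α : ℝ) (y : Fin 5) : IsPOVM (Bop α y) := by
  fin_cases y
  exacts [isPOVM_evm_pl_mn (isHermitian_saz α) (saz_mul_saz α),
    isPOVM_evm_pl_mn (isHermitian_sax α) (sax_mul_sax α),
    isPOVM_odm_mn_pl (isHermitian_saz α) (saz_mul_saz α),
    isPOVM_odm_mn_pl (isHermitian_sax α) (sax_mul_sax α), isPOVM_Aop 0]

end Sep

open Sep in
/-- `p*` is a genuine correlation: entries are nonnegative and,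
for each question pair, sum to 1. -/
theorem pstar_is_a_correlation (α : ℝ) (hα0 : 0 < α) (hα1 : α < 1)
    (x : Fin 4) (y : Fin 5) :
    (∀ a b : Fin 3, 0 ≤ pstar α x y a b) ∧ (∑ a : Fin 3, ∑ b : Fin 3, pstar α x y a b = 1) := by
  have h : 0 < 1 - α ^ 2 := by nlinarith
  refine ⟨fun a b => mul_nonneg h.le (tsum_pow_mul_mul_nonneg ((isPOVM_Aop x).posSemidef a)
    ((isPOVM_Bop α y).posSemidef b) α), ?_⟩
  simp_rw [pstar, ← Finset.mul_sum]
  rw [(isPOVM_Aop x).sum_tsum_pow_mul hα0.le hα1 (isPOVM_Bop α y), mul_inv_cancel₀ h.ne']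
end
end

section
/- For questions x, y ∈ {0,1}, the ideal correlation p* coincides with the ideal tilted CHSH correlation for ratio α: p*(a,b|x,y) = q(a,b|x,y) for all a,b ∈ {0,1}, and p*(a,b|x,y) = 0 whenever a = 2 or b = 2. -/
open Matrix Kronecker

noncomputable section

namespace Sep

/-- Alice's ideal tilted-CHSH projections: `M_x^0, M_x^1` are the projections onto the
`+1`- and `-1`-eigenspaces of `σz` (for `x = 0`) and of `σx` (for `x = 1`). -/
def Mop : Fin 2 → Fin 2 → Matrix (Fin 2) (Fin 2) ℝ :=
  ![![pl sz, mn sz], ![pl sx, mn sx]]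

/-- Bob's ideal tilted-CHSH projections, with `σαz`, `σαx`. -/
def Nop (α : ℝ) : Fin 2 → Fin 2 → Matrix (Fin 2) (Fin 2) ℝ :=
  ![![pl (saz α), mn (saz α)], ![pl (sax α), mn (sax α)]]

/-- The vector `|00⟩ + α|11⟩`. -/
def vtilt (α : ℝ) : Fin 2 × Fin 2 → ℝ :=
  fun p => if p = (0, 0) then 1 else if p = (1, 1) then α else 0

/-- The ideal tilted CHSH correlation for ratio `α`:
`q(a,b|x,y) = cos²θ ⟨v, (M_x^a ⊗ N_y^b) v⟩` with `θ = arctan α`, `v = |00⟩ + α|11⟩`. -/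
def tilted (α : ℝ) (x y a b : Fin 2) : ℝ :=
  Real.cos (Real.arctan α) ^ 2 *
    (vtilt α ⬝ᵥ ((Mop x a ⊗ₖ Nop α y b) *ᵥ vtilt α))

end Sep

namespace Sep

theorem evm_block_apply (m : ℕ) (O : Matrix (Fin 2) (Fin 2) ℝ) (n : ℕ) (r s : Fin 2) :
    evm n O (2 * m + r) (2 * m + s) = if n = m then O r s else 0 := by
  unfold evm embed
  split_ifs with h
  · subst h
    fin_cases r <;> fin_cases s <;> simp
  · refine Finset.sum_eq_zero fun r' _ => Finset.sum_eq_zero fun s' _ => if_neg ?_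
    have := r.isLt
    have := r'.isLt
    dsimp only
    omega

/-- On its diagonal blocks, the sum `Σ_m ev_m(O)` is `O`. -/
theorem sumB_evm_apply (O : Matrix (Fin 2) (Fin 2) ℝ) (m : ℕ) (r s : Fin 2) :
    sumB (fun n => evm n O) (2 * m + r) (2 * m + s) = O r s := by
  simp only [sumB, evm_block_apply, tsum_ite_eq]

/-- Off the diagonal blocks, the sum `Σ_m ev_m(O)` vanishes. -/
theorem sumB_evm_eq_zero (O : Matrix (Fin 2) (Fin 2) ℝ) {i j : ℕ} (h : i / 2 ≠ j / 2) :
    sumB (fun n => evm n O) i j = 0 := by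
  have h0 (n : ℕ) : evm n O i j = 0 := by
    unfold evm embed
    refine Finset.sum_eq_zero fun r _ => Finset.sum_eq_zero fun s _ => if_neg ?_
    have := r.isLt
    have := s.isLt
    dsimp only
    omega
  simp only [sumB, h0, tsum_zero]

/-- The position of entry `(r, s)` of the `m`-th diagonal block of size two. -/
def blockPos (p : ℕ × (Fin 2 × Fin 2)) : ℕ × ℕ :=
  (2 * p.1 + p.2.1, 2 * p.1 + p.2.2)

theorem blockPos_injective : Function.Injective blockPos := by
  rintro ⟨m, r, s⟩ ⟨m', r', s'⟩ h
  simp only [blockPos, Prod.mk.injEq] at h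
  simp only [Prod.mk.injEq, Fin.ext_iff]
  have := r.isLt
  have := r'.isLt
  omega

theorem mem_range_blockPos {i j : ℕ} (h : i / 2 = j / 2) : (i, j) ∈ Set.range blockPos := by
  refine ⟨(i / 2, ⟨i % 2, by omega⟩, ⟨j % 2, by omega⟩), ?_⟩
  simp only [blockPos, Prod.mk.injEq]
  omega

theorem tsum_pow_mul_sumB_evm {α : ℝ} (hα0 : 0 < α) (hα1 : α < 1)
    (O O' : Matrix (Fin 2) (Fin 2) ℝ) :
    ∑' ik : ℕ × ℕ, α ^ (ik.1 + ik.2) * sumB (fun m => evm m O) ik.1 ik.2 *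
        sumB (fun m => evm m O') ik.1 ik.2 =
      (1 - α ^ 4)⁻¹ * ∑ q : Fin 2 × Fin 2, α ^ (q.1 + q.2 : ℕ) * O q.1 q.2 * O' q.1 q.2 := by
  have h4 : α ^ 4 < 1 := pow_lt_one₀ hα0.le hα1 (by norm_num)
  have h4' : 0 ≤ α ^ 4 := by positivity
  rw [← blockPos_injective.tsum_eq, ← tsum_geometric_of_lt_one h4' h4, ← tsum_fintype (L := .unconditional _),
    tsum_mul_tsum_of_summable_norm (summable_geometric_of_lt_one h4' h4).norm
      (Summable.of_finite)]
  · refine tsum_congr fun p => ?_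
    simp only [blockPos, sumB_evm_apply]
    ring
  · rintro ⟨i, j⟩ hij
    refine mem_range_blockPos ?_
    by_contra h
    exact hij (by simp [sumB_evm_eq_zero O h])

theorem vtilt_dotProduct_kronecker (α : ℝ) (O O' : Matrix (Fin 2) (Fin 2) ℝ) :
    vtilt α ⬝ᵥ ((O ⊗ₖ O') *ᵥ vtilt α) =
      ∑ q : Fin 2 × Fin 2, α ^ (q.1 + q.2 : ℕ) * O q.1 q.2 * O' q.1 q.2 := by
  simp [dotProduct, mulVec, vtilt, Fintype.sum_prod_type]
  ring

theorem one_sub_sq_mul_tsum_eq_tilted {α : ℝ} (hα0 : 0 < α) (hα1 : α < 1)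
    (O O' : Matrix (Fin 2) (Fin 2) ℝ) :
    (1 - α ^ 2) * ∑' ik : ℕ × ℕ, α ^ (ik.1 + ik.2) * sumB (fun m => evm m O) ik.1 ik.2 *
        sumB (fun m => evm m O') ik.1 ik.2 =
      Real.cos (Real.arctan α) ^ 2 * (vtilt α ⬝ᵥ ((O ⊗ₖ O') *ᵥ vtilt α)) := by
  have h2 : 1 - α ^ 2 ≠ 0 := by nlinarith
  have h2' : 1 + α ^ 2 ≠ 0 := by positivity
  rw [tsum_pow_mul_sumB_evm hα0 hα1, vtilt_dotProduct_kronecker, Real.cos_sq_arctan, ← mul_assoc]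
  congr 1
  rw [show 1 - α ^ 4 = (1 - α ^ 2) * (1 + α ^ 2) by ring]
  field_simp

theorem Aop_two (h : 2 ≤ 4) (x : Fin 2) : Aop (x.castLE h) 2 = 0 := by
  fin_cases x <;> rfl

theorem Bop_two (α : ℝ) (h : 2 ≤ 5) (y : Fin 2) : Bop α (y.castLE h) 2 = 0 := by
  fin_cases y <;> rfl

theorem Aop_castLE (h : 2 ≤ 4) (h' : 2 ≤ 3) (x a : Fin 2) :
    Aop (x.castLE h) (a.castLE h') = sumB (fun m => evm m (Mop x a)) := by
  fin_cases x <;> fin_cases a <;> rfl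

theorem Bop_castLE (α : ℝ) (h : 2 ≤ 5) (h' : 2 ≤ 3) (y b : Fin 2) :
    Bop α (y.castLE h) (b.castLE h') = sumB (fun m => evm m (Nop α y b)) := by
  fin_cases y <;> fin_cases b <;> rfl

end Sep

open Sep in
/-- for questions `x, y ∈ {0,1}`, `p*` coincides with the ideal tilted
CHSH correlation for ratio `α`, and vanishes when `a = 2` or `b = 2`. -/
theorem pstar_restriction_eq_tilted_chsh (α : ℝ) (hα0 : 0 < α) (hα1 : α < 1)
    (x y : Fin 2) :
    (∀ a b : Fin 2,
      pstar α (x.castLE (by omega)) (y.castLE (by omega))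
        (a.castLE (by omega)) (b.castLE (by omega)) = tilted α x y a b) ∧
    (∀ a b : Fin 3, (a = 2 ∨ b = 2) →
      pstar α (x.castLE (by omega)) (y.castLE (by omega)) a b = 0) := by
  refine ⟨fun a b => ?_, ?_⟩
  · rw [pstar, Aop_castLE, Bop_castLE]
    exact one_sub_sq_mul_tsum_eq_tilted hα0 hα1 _ _
  · rintro a b (rfl | rfl)
    · simp [pstar, Aop_two]
    · simp [pstar, Bop_two]
end
end

section
/- For questions x, y ∈ {2,3}, the ideal correlation p* decomposes as a weighted direct sum of a tilted CHSH block and a point mass: p*(2,2|x,y) = 1−α²; p*(a,b|x,y) = 0 whenever exactly one of a, b equals 2; and for a,b ∈ {0,1}, p*(a,b|x,y) = α² · q(1−a, 1−b | x−2, y−2), where q is the ideal tilted CHSH correlation for ratio α. -/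
open Matrix Kronecker

noncomputable section

namespace Sep

theorem odm_apply_add (m : ℕ) (O : Matrix (Fin 2) (Fin 2) ℝ) (r s : Fin 2) :
    odm m O (2 * m + 1 + r) (2 * m + 1 + s) = O r s := by
  fin_cases r <;> fin_cases s <;> simp [odm, embed]

theorem odm_ne_zero {m i j : ℕ} {O : Matrix (Fin 2) (Fin 2) ℝ} (h : odm m O i j ≠ 0) :
    ∃ r s : Fin 2, i = 2 * m + 1 + r ∧ j = 2 * m + 1 + s := by
  contrapose! h
  have hne (r s : Fin 2) : ¬(i = 2 * m + 1 + r ∧ j = 2 * m + 1 + s) :=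
    fun hrs => h r s hrs.1 hrs.2
  simp only [odm, embed, hne, if_false, Finset.sum_const_zero]

theorem sumB_odm_apply_add (m : ℕ) (O : Matrix (Fin 2) (Fin 2) ℝ) (r s : Fin 2) :
    sumB (fun m => odm m O) (2 * m + 1 + r) (2 * m + 1 + s) = O r s := by
  refine (tsum_eq_single m fun m' hm' => ?_).trans (odm_apply_add m O r s)
  by_contra h
  obtain ⟨r', s', hr, -⟩ := odm_ne_zero h
  omega

theorem sumB_odm_ne_zero {i j : ℕ} {O : Matrix (Fin 2) (Fin 2) ℝ}
    (h : sumB (fun m => odm m O) i j ≠ 0) :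
    ∃ (m : ℕ) (r s : Fin 2), i = 2 * m + 1 + r ∧ j = 2 * m + 1 + s := by
  contrapose! h
  have hzero (m : ℕ) : odm m O i j = 0 := by
    by_contra hm
    obtain ⟨r, s, hr, hs⟩ := odm_ne_zero hm
    exact h m r s hr hs
  simp [sumB, hzero]

theorem sumB_odm_zero_zero (O : Matrix (Fin 2) (Fin 2) ℝ) :
    sumB (fun m => odm m O) 0 0 = 0 := by
  by_contra h
  obtain ⟨m, r, s, hr, -⟩ := sumB_odm_ne_zero h
  omega

theorem E00_mul_sumB_odm (O : Matrix (Fin 2) (Fin 2) ℝ) (i j : ℕ) :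
    E00 i j * sumB (fun m => odm m O) i j = 0 := by
  by_cases h : i = 0 ∧ j = 0
  · rw [h.1, h.2, sumB_odm_zero_zero, mul_zero]
  · simp [E00, h]

theorem tsum_E00_E00 (α : ℝ) :
    ∑' ik : ℕ × ℕ, α ^ (ik.1 + ik.2) * E00 ik.1 ik.2 * E00 ik.1 ik.2 = 1 := by
  rw [tsum_eq_single (0, 0)]
  · simp [E00]
  · rintro ⟨i, k⟩ h
    simp only [ne_eq, Prod.mk.injEq] at h
    simp [E00, h]

theorem tsum_E00_sumB_odm (α : ℝ) (O : Matrix (Fin 2) (Fin 2) ℝ) :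
    ∑' ik : ℕ × ℕ, α ^ (ik.1 + ik.2) * E00 ik.1 ik.2 * sumB (fun m => odm m O) ik.1 ik.2 = 0 := by
  simp [mul_assoc, E00_mul_sumB_odm]

theorem tsum_sumB_odm_E00 (α : ℝ) (O : Matrix (Fin 2) (Fin 2) ℝ) :
    ∑' ik : ℕ × ℕ, α ^ (ik.1 + ik.2) * sumB (fun m => odm m O) ik.1 ik.2 * E00 ik.1 ik.2 = 0 := by
  simp [mul_assoc, mul_comm (sumB _ _ _), E00_mul_sumB_odm]

/-- The positions of the entries of the odd blocks, indexed by the block and the entry in it. -/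
def oddIndex (p : ℕ × Fin 2 × Fin 2) : ℕ × ℕ :=
  (2 * p.1 + 1 + p.2.1, 2 * p.1 + 1 + p.2.2)

theorem oddIndex_injective : Function.Injective oddIndex := by
  rintro ⟨m, r, s⟩ ⟨m', r', s'⟩ h
  simp only [oddIndex, Prod.mk.injEq] at h
  obtain rfl : m = m' := by omega
  obtain rfl : r = r' := by omega
  obtain rfl : s = s' := by omega
  rfl

theorem tsum_sumB_odm_sumB_odm {α : ℝ} (h0 : 0 < α) (h1 : α < 1)
    (O O' : Matrix (Fin 2) (Fin 2) ℝ) :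
    ∑' ik : ℕ × ℕ, α ^ (ik.1 + ik.2) * sumB (fun m => odm m O) ik.1 ik.2 *
        sumB (fun m => odm m O') ik.1 ik.2 =
      (1 - α ^ 4)⁻¹ *
        (α ^ 2 * ∑ p : Fin 2 × Fin 2, α ^ ((p.1 : ℕ) + p.2) * O p.1 p.2 * O' p.1 p.2) := by
  have hα4 : α ^ 4 < 1 := pow_lt_one₀ h0.le h1 (by norm_num)
  rw [← oddIndex_injective.tsum_eq]
  · have key : ∀ p : ℕ × Fin 2 × Fin 2,
        α ^ ((oddIndex p).1 + (oddIndex p).2) *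
            sumB (fun m => odm m O) (oddIndex p).1 (oddIndex p).2 *
            sumB (fun m => odm m O') (oddIndex p).1 (oddIndex p).2 =
          (α ^ 4) ^ p.1 *
            (α ^ 2 * (α ^ ((p.2.1 : ℕ) + p.2.2) * O p.2.1 p.2.2 * O' p.2.1 p.2.2)) := by
      rintro ⟨m, r, s⟩
      simp only [oddIndex, sumB_odm_apply_add]
      ring
    rw [tsum_congr key, ← tsum_geometric_of_lt_one (by positivity) hα4,
      Finset.mul_sum, ← tsum_fintype (L := .unconditional _)]
    have hgeom : Summable fun m : ℕ => ‖(α ^ 4) ^ m‖ :=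
      (summable_geometric_of_lt_one (by positivity) hα4).norm
    have hentries : Summable fun p : Fin 2 × Fin 2 =>
        ‖α ^ 2 * (α ^ ((p.1 : ℕ) + p.2) * O p.1 p.2 * O' p.1 p.2)‖ := Summable.of_finite
    exact (tsum_mul_tsum_of_summable_norm hgeom hentries).symm
  · rintro ⟨i, k⟩ h
    obtain ⟨m, r, s, rfl, rfl⟩ := sumB_odm_ne_zero (right_ne_zero_of_mul h)
    exact ⟨(m, r, s), rfl⟩

theorem tilted_eq_sum (α : ℝ) (x y a b : Fin 2) :
    tilted α x y a b = (1 + α ^ 2)⁻¹ *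
      ∑ p : Fin 2 × Fin 2, α ^ ((p.1 : ℕ) + p.2) * Mop x a p.1 p.2 * Nop α y b p.1 p.2 := by
  rw [tilted, Real.cos_sq_arctan, one_div]
  congr 1
  simp only [dotProduct, mulVec, Fintype.sum_prod_type, Fin.sum_univ_two, vtilt, kroneckerMap_apply]
  simp
  ring

theorem Aop_answer_two (x : Fin 2) (hx : x.val + 2 < 4) : Aop ⟨x.val + 2, hx⟩ 2 = E00 := by
  fin_cases x <;> rfl

theorem Bop_answer_two (α : ℝ) (y : Fin 2) (hy : y.val + 2 < 5) :
    Bop α ⟨y.val + 2, hy⟩ 2 = E00 := by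
  fin_cases y <;> rfl

theorem Aop_answer_castLE (x a : Fin 2) (hx : x.val + 2 < 4) (h : 2 ≤ 3) :
    Aop ⟨x.val + 2, hx⟩ (a.castLE h) =
      sumB fun m => odm m (Mop x (1 - a)) := by
  fin_cases x <;> fin_cases a <;> rfl

theorem Bop_answer_castLE (α : ℝ) (y b : Fin 2) (hy : y.val + 2 < 5) (h : 2 ≤ 3) :
    Bop α ⟨y.val + 2, hy⟩ (b.castLE h) =
      sumB fun m => odm m (Nop α y (1 - b)) := by
  fin_cases y <;> fin_cases b <;> rfl

theorem exists_castLE_of_ne_two {a : Fin 3} (ha : a ≠ 2) (h : 2 ≤ 3) :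
    ∃ a' : Fin 2, a = a'.castLE h :=
  ⟨⟨a, by omega⟩, rfl⟩

end Sep

open Sep in
/-- for questions `x, y ∈ {2,3}`, `p*` is a weighted direct sum of a
tilted CHSH block (weight `α²`, with flipped answer labels) and a point mass at
`(2,2)` (weight `1-α²`). -/
theorem pstar_restriction_23_block_structure (α : ℝ) (hα0 : 0 < α) (hα1 : α < 1)
    (x y : Fin 2) :
    pstar α ⟨x.val + 2, by have := x.isLt; omega⟩ ⟨y.val + 2, by have := y.isLt; omega⟩ 2 2
        = 1 - α ^ 2 ∧
    (∀ a b : Fin 3, ((a = 2 ∧ b ≠ 2) ∨ (a ≠ 2 ∧ b = 2)) →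
      pstar α ⟨x.val + 2, by have := x.isLt; omega⟩ ⟨y.val + 2, by have := y.isLt; omega⟩ a b
        = 0) ∧
    (∀ a b : Fin 2,
      pstar α ⟨x.val + 2, by have := x.isLt; omega⟩ ⟨y.val + 2, by have := y.isLt; omega⟩
          (a.castLE (by omega)) (b.castLE (by omega))
        = α ^ 2 * tilted α x y (1 - a) (1 - b)) := by
  refine ⟨?_, ?_, fun a b => ?_⟩
  · rw [pstar, Aop_answer_two, Bop_answer_two, tsum_E00_E00, mul_one]
  · rintro a b (⟨rfl, hb⟩ | ⟨ha, rfl⟩)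
    · obtain ⟨b, rfl⟩ := exists_castLE_of_ne_two hb (Nat.le_succ 2)
      rw [pstar, Aop_answer_two, Bop_answer_castLE, tsum_E00_sumB_odm, mul_zero]
    · obtain ⟨a, rfl⟩ := exists_castLE_of_ne_two ha (Nat.le_succ 2)
      rw [pstar, Aop_answer_castLE, Bop_answer_two, tsum_sumB_odm_E00, mul_zero]
  · rw [pstar, Aop_answer_castLE, Bop_answer_castLE, tsum_sumB_odm_sumB_odm hα0 hα1,
      tilted_eq_sum]
    have hsub : 1 - α ^ 2 ≠ 0 := by nlinarith
    have hfactor : 1 - α ^ 4 = (1 - α ^ 2) * (1 + α ^ 2) := by ring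
    rw [hfactor]
    field_simp
end
end

section
/- On the question pair (x,y) = (0,4), the ideal correlation p* is diagonal: p*(0,0|0,4) = 1/(1+α²), p*(1,1|0,4) = α²/(1+α²), and p*(a,b|0,4) = 0 for all other pairs (a,b) ∈ {0,1,2}×{0,1,2}. -/
open Matrix Kronecker

noncomputable section

namespace Sep

theorem sumB_evm_diagonal (c : Fin 2 → ℝ) (i j : ℕ) :
    sumB (fun m => evm m (Matrix.diagonal c)) i j =
      if i = j then (if i % 2 = 0 then c 0 else c 1) else 0 := by
  have h : ∀ m, evm m (Matrix.diagonal c) i j =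
      if m = i / 2 then (if i = j then (if i % 2 = 0 then c 0 else c 1) else 0) else 0 := by
    intro m
    simp only [evm, embed, Fin.sum_univ_two, Matrix.diagonal_apply_eq, ne_eq, zero_ne_one,
      one_ne_zero, not_false_eq_true, Matrix.diagonal_apply_ne, ite_self, add_zero, zero_add,
      Fin.val_zero, Fin.val_one]
    split_ifs <;> first | (exfalso; omega) | simp only [add_zero, zero_add]
  simp only [sumB, h, tsum_ite_eq]

theorem pl_sz : pl sz = Matrix.diagonal ![1, 0] := by
  ext i j
  fin_cases i <;> fin_cases j <;> norm_num [pl, sz]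

theorem mn_sz : mn sz = Matrix.diagonal ![0, 1] := by
  ext i j
  fin_cases i <;> fin_cases j <;> norm_num [mn, sz]

theorem Aop_zero_zero (i j : ℕ) :
    Aop 0 0 i j = if i = j ∧ i % 2 = 0 then 1 else 0 := by
  change sumB (fun m => evm m (pl sz)) i j = _
  rw [pl_sz, sumB_evm_diagonal]
  split_ifs <;> first | (exfalso; omega) | rfl

theorem Aop_zero_one (i j : ℕ) :
    Aop 0 1 i j = if i = j ∧ i % 2 = 1 then 1 else 0 := by
  change sumB (fun m => evm m (mn sz)) i j = _
  rw [mn_sz, sumB_evm_diagonal]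
  split_ifs <;> first | (exfalso; omega) | rfl

theorem Aop_zero_two (i j : ℕ) : Aop 0 2 i j = 0 := rfl

theorem Bop_four (α : ℝ) (b : Fin 3) : Bop α 4 b = Aop 0 b := by
  fin_cases b <;> rfl

/-- The geometric series over the diagonal entries of a fixed parity `r`. -/
theorem tsum_diagonal_parity (α : ℝ) (hα0 : 0 < α) (hα1 : α < 1) (r : ℕ) (hr : r < 2)
    (f : ℕ × ℕ → ℝ)
    (hf : ∀ p, f p = if p.1 = p.2 ∧ p.1 % 2 = r then α ^ (p.1 + p.2) else 0) :
    ∑' p, f p = α ^ (2 * r) * (1 - α ^ 4)⁻¹ := by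
  have hinj : Function.Injective (fun n : ℕ => (2 * n + r, 2 * n + r)) := by
    intro a b h
    simp only [Prod.mk.injEq] at h
    omega
  have hsupp : Function.support f ⊆ Set.range (fun n : ℕ => (2 * n + r, 2 * n + r)) := by
    rintro ⟨i, j⟩ h
    rw [Function.mem_support, hf] at h
    obtain ⟨hij, hi⟩ := of_not_not fun hn => h (if_neg hn)
    simp only at hij hi
    exact ⟨i / 2, Prod.ext (by simp only; omega) (by simp only; omega)⟩
  have hval : ∀ n : ℕ, f (2 * n + r, 2 * n + r) = α ^ (2 * r) * (α ^ 4) ^ n := by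
    intro n
    rw [hf, if_pos ⟨rfl, by simp only; omega⟩, ← pow_mul, ← pow_add]
    congr 1
    simp only
    ring
  rw [← hinj.tsum_eq hsupp]
  simp only [hval]
  rw [tsum_mul_left, tsum_geometric_of_lt_one (by positivity) (pow_lt_one₀ hα0.le hα1 (by norm_num))]

end Sep

open Sep in
/-- on the question pair `(x,y) = (0,4)`, `p*` is diagonal, with
`p*(0,0|0,4) = 1/(1+α²)`, `p*(1,1|0,4) = α²/(1+α²)`, and all other entries zero. -/
theorem pstar_04_diagonal (α : ℝ) (hα0 : 0 < α) (hα1 : α < 1) :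
    pstar α 0 4 0 0 = 1 / (1 + α ^ 2) ∧
    pstar α 0 4 1 1 = α ^ 2 / (1 + α ^ 2) ∧
    (∀ a b : Fin 3, ¬((a = 0 ∧ b = 0) ∨ (a = 1 ∧ b = 1)) → pstar α 0 4 a b = 0) := by
  have h1 : (1 - α ^ 2) ≠ 0 := by nlinarith
  have h2 : (1 + α ^ 2) ≠ 0 := by positivity
  have h4 : 1 - α ^ 4 = (1 - α ^ 2) * (1 + α ^ 2) := by ring
  refine ⟨?_, ?_, ?_⟩
  · rw [pstar, tsum_diagonal_parity α hα0 hα1 0 (by norm_num), h4]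
    · rw [mul_zero, pow_zero]
      field_simp
    · intro p
      rw [Bop_four, Aop_zero_zero]
      split_ifs <;> simp
  · rw [pstar, tsum_diagonal_parity α hα0 hα1 1 (by norm_num), h4]
    · field_simp
    · intro p
      rw [Bop_four, Aop_zero_one]
      split_ifs <;> simp
  · intro a b hab
    have hz : ∀ i k : ℕ, Aop 0 a i k * Aop 0 b i k = 0 := by
      intro i k
      fin_cases a <;> fin_cases b <;>
        simp [Aop_zero_zero, Aop_zero_one, Aop_zero_two] at hab ⊢ <;> omega
    simp only [pstar, Bop_four, mul_assoc, hz, mul_zero, tsum_zero]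
end
end

section
/- Let X, Y be finite nonempty question sets, A, B finite answer sets, A_i ⊆ A and B_i ⊆ B subsets, and suppose a finite-dimensional strategy (ψ, {P_x^a}, {Q_y^b}) induces a correlation p such that p(a,b|x,y) = 0 for all x, y whenever (a ∈ A_i and b ∉ B_i) or (a ∉ A_i and b ∈ B_i). Writing Π_x = Σ_{a∈A_i} P_x^a and Θ_y = Σ_{b∈B_i} Q_y^b, we have for all x ∈ X and y ∈ Y: (Π_x ⊗ I)ψ = (Π_x ⊗ Θ_y)ψ = (I ⊗ Θ_y)ψ. In particular, (Π_x ⊗ I)ψ is independent of x and (I ⊗ Θ_y)ψ is independent of y. -/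
open Matrix

noncomputable section

namespace Sep

/-- A finite-dimensional strategy on question sets `X`, `Y` and answer sets `A`, `B`:
a unit vector `ψ` together with projective measurements for each question. -/
structure GStrategy (X Y A B : Type) [Fintype A] [Fintype B] (dA dB : ℕ) where
  ψ : Fin dA × Fin dB → ℂ
  P : X → A → Matrix (Fin dA) (Fin dA) ℂ
  Q : Y → B → Matrix (Fin dB) (Fin dB) ℂ
  unit : ∑ p : Fin dA × Fin dB, Complex.normSq (ψ p) = 1
  P_sa : ∀ x a, (P x a)ᴴ = P x a
  P_proj : ∀ x a, P x a * P x a = P x a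
  P_complete : ∀ x, ∑ a, P x a = 1
  Q_sa : ∀ y b, (Q y b)ᴴ = Q y b
  Q_proj : ∀ y b, Q y b * Q y b = Q y b
  Q_complete : ∀ y, ∑ b, Q y b = 1

/-- The sesquilinear value `⟨φ, (P ⊗ Q) φ'⟩`. -/
def corr {dA dB : ℕ} (P : Matrix (Fin dA) (Fin dA) ℂ) (Q : Matrix (Fin dB) (Fin dB) ℂ)
    (φ φ' : Fin dA × Fin dB → ℂ) : ℂ :=
  ∑ p : Fin dA × Fin dB, (starRingEnd ℂ) (φ p) * actA P (actB Q φ') p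

end Sep

namespace Sep

open scoped Kronecker

theorem actA_actB_eq_kronecker_mulVec {dA dB : ℕ} (P : Matrix (Fin dA) (Fin dA) ℂ)
    (Q : Matrix (Fin dB) (Fin dB) ℂ) (φ : Fin dA × Fin dB → ℂ) :
    actA P (actB Q φ) = (P ⊗ₖ Q) *ᵥ φ := by
  ext p
  simp only [actA, actB, mulVec, dotProduct, Fintype.sum_prod_type, kroneckerMap_apply,
    Finset.mul_sum, mul_assoc]

theorem actA_one {dA dB : ℕ} (φ : Fin dA × Fin dB → ℂ) : actA 1 φ = φ := by
  ext p
  simp [actA, one_apply]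

theorem actB_one {dA dB : ℕ} (φ : Fin dA × Fin dB → ℂ) : actB 1 φ = φ := by
  ext p
  simp [actB, one_apply]

open scoped ComplexOrder in
/-- A vanishing expectation value of a product of projections forces the product to
annihilate the vector. -/
theorem actA_actB_eq_zero_of_corr_eq_zero {dA dB : ℕ} {P : Matrix (Fin dA) (Fin dA) ℂ}
    {Q : Matrix (Fin dB) (Fin dB) ℂ} {φ : Fin dA × Fin dB → ℂ} (hPsa : Pᴴ = P) (hP : P * P = P)
    (hQsa : Qᴴ = Q) (hQ : Q * Q = Q) (h : corr P Q φ φ = 0) :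
    actA P (actB Q φ) = 0 := by
  have hM : (P ⊗ₖ Q)ᴴ * (P ⊗ₖ Q) = P ⊗ₖ Q := by
    rw [conjTranspose_kronecker, hPsa, hQsa, ← mul_kronecker_mul, hP, hQ]
  have h' : star φ ⬝ᵥ ((P ⊗ₖ Q) *ᵥ φ) = 0 := by
    rw [← actA_actB_eq_kronecker_mulVec]
    exact h
  rw [← hM, ← mulVec_mulVec, dotProduct_mulVec, ← star_mulVec] at h'
  rw [actA_actB_eq_kronecker_mulVec]
  exact dotProduct_star_self_eq_zero.mp h'

theorem actA_sum_actB_sum {dA dB : ℕ} {A B : Type*} (s : Finset A) (t : Finset B)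
    (P : A → Matrix (Fin dA) (Fin dA) ℂ) (Q : B → Matrix (Fin dB) (Fin dB) ℂ)
    (φ : Fin dA × Fin dB → ℂ) :
    actA (∑ a ∈ s, P a) (actB (∑ b ∈ t, Q b) φ)
      = ∑ a ∈ s, ∑ b ∈ t, actA (P a) (actB (Q b) φ) := by
  have h : (∑ a ∈ s, P a) ⊗ₖ (∑ b ∈ t, Q b) = ∑ a ∈ s, ∑ b ∈ t, P a ⊗ₖ Q b := by
    ext i j
    simp only [kroneckerMap_apply, Matrix.sum_apply, Finset.sum_mul_sum]
  simp only [actA_actB_eq_kronecker_mulVec, h, sum_mulVec]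

end Sep

open Sep in
/-- if the induced correlation vanishes whenever exactly one of the answers
lies in the block `(A_i, B_i)`, then `(Π_x ⊗ I)ψ = (Π_x ⊗ Θ_y)ψ = (I ⊗ Θ_y)ψ` for all
`x, y`, where `Π_x = Σ_{a∈A_i} P_x^a` and `Θ_y = Σ_{b∈B_i} Q_y^b`; in particular
`(Π_x ⊗ I)ψ` is independent of `x` and `(I ⊗ Θ_y)ψ` is independent of `y`. -/
theorem block_projectors_agree_on_state
    {X Y A B : Type} [Fintype X] [Fintype Y] [Nonempty X] [Nonempty Y]
    [Fintype A] [Fintype B] [DecidableEq A] [DecidableEq B]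
    {dA dB : ℕ} (hdA : 1 ≤ dA) (hdB : 1 ≤ dB)
    (S : GStrategy X Y A B dA dB) (Ai : Finset A) (Bi : Finset B)
    (hzero : ∀ (x : X) (y : Y) (a : A) (b : B),
      ((a ∈ Ai ∧ b ∉ Bi) ∨ (a ∉ Ai ∧ b ∈ Bi)) →
      corr (S.P x a) (S.Q y b) S.ψ S.ψ = 0) :
    (∀ (x : X) (y : Y),
      actA (∑ a ∈ Ai, S.P x a) S.ψ
          = actA (∑ a ∈ Ai, S.P x a) (actB (∑ b ∈ Bi, S.Q y b) S.ψ) ∧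
      actA (∑ a ∈ Ai, S.P x a) S.ψ = actB (∑ b ∈ Bi, S.Q y b) S.ψ) ∧
    (∀ x x' : X, actA (∑ a ∈ Ai, S.P x a) S.ψ = actA (∑ a ∈ Ai, S.P x' a) S.ψ) ∧
    (∀ y y' : Y, actB (∑ b ∈ Bi, S.Q y b) S.ψ = actB (∑ b ∈ Bi, S.Q y' b) S.ψ) := by
  have hxy : ∀ (x : X) (y : Y),
      actA (∑ a ∈ Ai, S.P x a) S.ψ
          = actA (∑ a ∈ Ai, S.P x a) (actB (∑ b ∈ Bi, S.Q y b) S.ψ) ∧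
      actA (∑ a ∈ Ai, S.P x a) S.ψ = actB (∑ b ∈ Bi, S.Q y b) S.ψ := by
    intro x y
    have hz : ∀ a b, ((a ∈ Ai ∧ b ∉ Bi) ∨ (a ∉ Ai ∧ b ∈ Bi)) →
        actA (S.P x a) (actB (S.Q y b) S.ψ) = 0 := fun a b hab =>
      actA_actB_eq_zero_of_corr_eq_zero (S.P_sa x a) (S.P_proj x a) (S.Q_sa y b) (S.Q_proj y b)
        (hzero x y a b hab)
    have hA : actA (∑ a ∈ Ai, S.P x a) S.ψ
        = actA (∑ a ∈ Ai, S.P x a) (actB (∑ b ∈ Bi, S.Q y b) S.ψ) := by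
      conv_lhs => rw [← actB_one S.ψ, ← S.Q_complete y]
      rw [actA_sum_actB_sum, actA_sum_actB_sum]
      refine Finset.sum_congr rfl fun a ha => ?_
      exact (Finset.sum_subset (Finset.subset_univ Bi)
        fun b _ hb => hz a b (Or.inl ⟨ha, hb⟩)).symm
    have hB : actB (∑ b ∈ Bi, S.Q y b) S.ψ
        = actA (∑ a ∈ Ai, S.P x a) (actB (∑ b ∈ Bi, S.Q y b) S.ψ) := by
      conv_lhs => rw [← actA_one (actB _ S.ψ), ← S.P_complete x]
      rw [actA_sum_actB_sum, actA_sum_actB_sum]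
      exact (Finset.sum_subset (Finset.subset_univ Ai) fun a _ ha =>
        Finset.sum_eq_zero fun b hb => hz a b (Or.inr ⟨ha, hb⟩)).symm
    exact ⟨hA, hA.trans hB.symm⟩
  obtain ⟨x₀⟩ := ‹Nonempty X›
  obtain ⟨y₀⟩ := ‹Nonempty Y›
  exact ⟨hxy, fun x x' => (hxy x y₀).2.trans (hxy x' y₀).2.symm,
    fun y y' => (hxy x₀ y).2.symm.trans (hxy x₀ y').2⟩
end
end

section
/- (Schmidt coefficients of a sum of locally orthogonal vectors.) Let M, P, N be d_A×d_B complex matrices with M = P + N, (P·Pᴴ)·(N·Nᴴ) = 0, and (Pᴴ·P)·(Nᴴ·N) = 0. Then the multiset of nonzero eigenvalues, counted with multiplicity, of M·Mᴴ equals the multiset sum (disjoint union) of the multiset of nonzero eigenvalues of P·Pᴴ and the multiset of nonzero eigenvalues of N·Nᴴ. -/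
open Matrix

open Polynomial in
/-- The characteristic polynomial of a sum of two matrices whose product vanishes. -/
theorem Matrix.charpoly_mul_charpoly_of_mul_eq_zero {n R : Type*} [Fintype n] [DecidableEq n]
    [CommRing R] {A B : Matrix n n R} (h : A * B = 0) :
    A.charpoly * B.charpoly = X ^ Fintype.card n * (A + B).charpoly := by
  have hmap : A.map (C : R →+* R[X]) * B.map (C : R →+* R[X]) = 0 := by
    rw [← Matrix.map_mul, h, Matrix.map_zero _ (map_zero _)]
  have hmatrix : charmatrix A * charmatrix B = (X : R[X]) • charmatrix (A + B) := by
    simp only [charmatrix, RingHom.mapMatrix_apply, Matrix.map_add _ (map_add (C : R →+* R[X])),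
      scalar_apply, ← smul_one_eq_diagonal, sub_mul, mul_sub, hmap, smul_mul_assoc,
      mul_smul_comm, one_mul, mul_one, smul_sub, smul_add]
    abel
  rw [charpoly, charpoly, charpoly, ← det_mul, hmatrix, det_smul]

open Polynomial in
/-- If the product of two matrices vanishes, the nonzero eigenvalues of their sum are those of
the summands, counted with multiplicity. -/
theorem Matrix.filter_roots_charpoly_add_of_mul_eq_zero {n R : Type*} [Fintype n] [DecidableEq n]
    [CommRing R] [IsDomain R] [DecidableEq R] {A B : Matrix n n R} (h : A * B = 0) :
    (A + B).charpoly.roots.filter (fun z => z ≠ 0)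
      = A.charpoly.roots.filter (fun z => z ≠ 0) + B.charpoly.roots.filter (fun z => z ≠ 0) := by
  have hroots := congrArg roots (charpoly_mul_charpoly_of_mul_eq_zero h)
  rw [roots_mul (mul_ne_zero A.charpoly_monic.ne_zero B.charpoly_monic.ne_zero),
    roots_mul (mul_ne_zero (pow_ne_zero _ X_ne_zero) (A + B).charpoly_monic.ne_zero),
    roots_pow, roots_X] at hroots
  rw [← Multiset.filter_add, hroots, Multiset.filter_add, Multiset.filter_nsmul,
    Multiset.filter_singleton]
  simp

/-- Schmidt coefficients of a sum of locally orthogonal vectors.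
If `M = P + N` with `(P·Pᴴ)(N·Nᴴ) = 0` and `(Pᴴ·P)(Nᴴ·N) = 0`, then the multiset of
nonzero eigenvalues (roots of the characteristic polynomial with `0` removed) of `M·Mᴴ`
is the multiset sum of those of `P·Pᴴ` and of `N·Nᴴ`. -/
theorem nonzero_eigenvalues_of_locally_orthogonal_sum
    (dA dB : ℕ) (M P N : Matrix (Fin dA) (Fin dB) ℂ)
    (hsum : M = P + N)
    (horthA : (P * Pᴴ) * (N * Nᴴ) = 0)
    (horthB : (Pᴴ * P) * (Nᴴ * N) = 0) :
    ((M * Mᴴ).charpoly.roots.filter (fun z => z ≠ 0))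
      = ((P * Pᴴ).charpoly.roots.filter (fun z => z ≠ 0))
        + ((N * Nᴴ).charpoly.roots.filter (fun z => z ≠ 0)) := by
  have hPN : P * Nᴴ = 0 := by
    open scoped ComplexOrder in
    rwa [conjTranspose_mul_self_mul_eq_zero,
      mul_conjTranspose_mul_self_eq_zero] at horthB
  have hNP : N * Pᴴ = 0 := by
    simpa using congrArg conjTranspose hPN
  have hM : M * Mᴴ = P * Pᴴ + N * Nᴴ := by
    rw [hsum, conjTranspose_add, Matrix.add_mul, Matrix.mul_add, Matrix.mul_add, hPN, hNP,
      add_zero, zero_add]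
  rw [hM]
  convert filter_roots_charpoly_add_of_mul_eq_zero horthA
end

section
/- (The ideal strategy attains the tilted CHSH maximum.) Let β be a real number with 0 ≤ β < 2, let θ ∈ (0, π/4] satisfy sin 2θ = √((4−β²)/(4+β²)), and set μ = arctan(sin 2θ) and α = tan θ. With σz = !![1,0;0,-1], σx = !![0,1;1,0], σαz = (cos μ)·σz + (sin μ)·σx, σαx = (cos μ)·σz − (sin μ)·σx, and Ψ = cos θ·(1,0,0,α) ∈ ℂ⁴ (the unit vector cos θ(|00⟩ + α|11⟩)), one has ⟨Ψ, (β·(σz⊗I) + σz⊗σαz + σz⊗σαx + σx⊗σαz − σx⊗σαx)·Ψ⟩ = √(8 + 2β²), where ⊗ denotes the Kronecker product of 2×2 matrices. -/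
open Matrix Kronecker

noncomputable section

namespace Sep

/-- The `α`-tilted Pauli `σαz = cos μ · σz + sin μ · σx`. -/
def tz (μ : ℝ) : Matrix (Fin 2) (Fin 2) ℝ := Real.cos μ • sz + Real.sin μ • sx

/-- The `α`-tilted Pauli `σαx = cos μ · σz - sin μ · σx`. -/
def tx (μ : ℝ) : Matrix (Fin 2) (Fin 2) ℝ := Real.cos μ • sz - Real.sin μ • sx

/-- The ideal state `cos θ (|00⟩ + α|11⟩)` with `α = tan θ`. -/
def idealState (θ : ℝ) : Fin 2 × Fin 2 → ℝ :=
  fun p => Real.cos θ *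
    (if p = (0, 0) then 1 else if p = (1, 1) then Real.tan θ else 0)

end Sep

namespace Sep

theorem tilted_chsh_idealState (β θ μ : ℝ) (hcos : Real.cos θ ≠ 0) :
    idealState θ ⬝ᵥ
      ((β • (sz ⊗ₖ (1 : Matrix (Fin 2) (Fin 2) ℝ))
          + sz ⊗ₖ tz μ + sz ⊗ₖ tx μ + sx ⊗ₖ tz μ - sx ⊗ₖ tx μ) *ᵥ idealState θ)
      = β * Real.cos (2 * θ) + 2 * Real.cos μ + 2 * Real.sin μ * Real.sin (2 * θ) := by
  have htan : Real.cos θ * Real.tan θ = Real.sin θ := by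
    rw [mul_comm, Real.tan_mul_cos hcos]
  simp [dotProduct, mulVec, Fintype.sum_prod_type, idealState, sz, sx, tz, tx, htan,
    kroneckerMap_apply]
  rw [Real.cos_two_mul, Real.sin_two_mul]
  linear_combination (2 * Real.cos μ - β) * Real.sin_sq_add_cos_sq θ

end Sep

open Sep in
/-- the ideal strategy attains the tilted CHSH quantum maximum
`√(8 + 2β²)`. -/
theorem ideal_strategy_attains_tilted_chsh_maximum
    (β θ : ℝ) (hβ0 : 0 ≤ β) (hβ2 : β < 2)
    (hθ0 : 0 < θ) (hθ1 : θ ≤ Real.pi / 4)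
    (hsin : Real.sin (2 * θ) = Real.sqrt ((4 - β ^ 2) / (4 + β ^ 2))) :
    idealState θ ⬝ᵥ
      ((β • (sz ⊗ₖ (1 : Matrix (Fin 2) (Fin 2) ℝ))
          + sz ⊗ₖ tz (Real.arctan (Real.sin (2 * θ)))
          + sz ⊗ₖ tx (Real.arctan (Real.sin (2 * θ)))
          + sx ⊗ₖ tz (Real.arctan (Real.sin (2 * θ)))
          - sx ⊗ₖ tx (Real.arctan (Real.sin (2 * θ)))) *ᵥ idealState θ)
      = Real.sqrt (8 + 2 * β ^ 2) := by
  have hcosθ : 0 < Real.cos θ :=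
    Real.cos_pos_of_mem_Ioo ⟨by linarith [Real.pi_pos], by linarith [Real.pi_pos]⟩
  have hcos2θ : 0 ≤ Real.cos (2 * θ) :=
    Real.cos_nonneg_of_mem_Icc ⟨by linarith [Real.pi_pos], by linarith⟩
  rw [tilted_chsh_idealState β θ _ hcosθ.ne', Real.cos_arctan, Real.sin_arctan]
  have hs : Real.sin (2 * θ) ^ 2 = (4 - β ^ 2) / (4 + β ^ 2) := by
    rw [hsin, Real.sq_sqrt]
    exact div_nonneg (by nlinarith) (by positivity)
  have hR : 0 < Real.sqrt (8 + 2 * β ^ 2) := Real.sqrt_pos.2 (by positivity)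
  have hR2 : Real.sqrt (8 + 2 * β ^ 2) ^ 2 = 8 + 2 * β ^ 2 := Real.sq_sqrt (by positivity)
  set R := Real.sqrt (8 + 2 * β ^ 2)
  set s := Real.sin (2 * θ)
  have hc : Real.cos (2 * θ) = 2 * β / R := by
    rw [← sq_eq_sq₀ hcos2θ (by positivity), Real.cos_sq', hs, div_pow, hR2]
    field_simp
    ring
  have hq : Real.sqrt (1 + s ^ 2) = 4 / R := by
    rw [Real.sqrt_eq_iff_eq_sq (by positivity) (by positivity), div_pow, hR2, hs]
    field_simp
    ring
  have hs' : s ^ 2 = 16 / R ^ 2 - 1 := by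
    rw [hs, hR2]
    field_simp
    ring
  rw [hc, hq]
  field_simp
  rw [hs']
  field_simp
  linear_combination (-4 : ℝ) * hR2
end
end
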